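/- For every even Schwartz function ρ on ℝ with ∫_ℝ ρ(y) dy = 1 and every x ∈ ℝ: lim_{L → ∞} [ ((ρ^L * ρ^L * Θ_x)(x))² − ∫_ℝ ((ρ^L * ρ^L * Θ_x)(z))² σ(z) dz ] = −1/12, where ρ^L(y) := Lρ(Ly). -/

import Mathlib

open MeasureTheory Real Filter

/-- `Θ_x(z) = 1_{(-∞,x]}(z) - ∫_z^∞ σ(y) dy`. -/
noncomputable def Theta (σ : ℝ → ℝ) (x z : ℝ) : ℝ :=
  Set.indicator (Set.Iic x) (fun _ => (1 : ℝ)) z - ∫ y in Set.Ioi z, σ y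

/-- The rescaled mollifier `ρ^L(y) = L ρ(L y)`. -/
noncomputable def mollify (ρ : ℝ → ℝ) (L : ℕ) (y : ℝ) : ℝ := (L : ℝ) * ρ ((L : ℝ) * y)

/-- `(ρ^L * ρ^L * Θ_x)(t)`, the double convolution evaluated at `t`. -/
noncomputable def doubleConv (σ : ℝ → ℝ) (ρ : ℝ → ℝ) (L : ℕ) (x t : ℝ) : ℝ :=
  ∫ z, (∫ w, mollify ρ L (t - z - w) * mollify ρ L w) * Theta σ x z

open scoped Topology

section Tail

variable {σ : ℝ → ℝ}

theorem hasDerivAt_integral_Ioi (hc : Continuous σ) (hi : Integrable σ) (z : ℝ) :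
    HasDerivAt (fun z => ∫ y in Set.Ioi z, σ y) (-σ z) z := by
  have h : (fun z => ∫ y in Set.Ioi z, σ y) =
      fun z => (∫ y in Set.Ioi 0, σ y) - ∫ y in (0 : ℝ)..z, σ y := by
    funext z
    rw [← intervalIntegral.integral_interval_add_Ioi (a := 0) (b := z)
      hi.integrableOn hi.integrableOn]
    ring
  rw [h]
  exact (intervalIntegral.integral_hasDerivAt_right (hc.intervalIntegrable _ _)
    (hc.stronglyMeasurableAtFilter _ _) hc.continuousAt).const_sub _

theorem continuous_integral_Ioi (hc : Continuous σ) (hi : Integrable σ) :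
    Continuous fun z => ∫ y in Set.Ioi z, σ y :=
  continuous_iff_continuousAt.2 fun z => (hasDerivAt_integral_Ioi hc hi z).continuousAt

theorem tendsto_integral_Ioi_atTop (hi : Integrable σ) :
    Tendsto (fun z => ∫ y in Set.Ioi z, σ y) atTop (𝓝 0) := by
  have h := (intervalIntegral_tendsto_integral_Ioi 0 hi.integrableOn tendsto_id).const_sub
    (∫ y in Set.Ioi 0, σ y)
  rw [sub_self] at h
  refine h.congr fun z => ?_
  rw [← intervalIntegral.integral_interval_add_Ioi (a := 0) (b := z)
    hi.integrableOn hi.integrableOn]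
  simp

theorem tendsto_integral_Ioi_atBot (hi : Integrable σ) :
    Tendsto (fun z => ∫ y in Set.Ioi z, σ y) atBot (𝓝 (∫ y, σ y)) := by
  have h := (intervalIntegral_tendsto_integral_Iic 0 hi.integrableOn tendsto_id).add_const
    (∫ y in Set.Ioi 0, σ y)
  rw [intervalIntegral.integral_Iic_add_Ioi hi.integrableOn hi.integrableOn] at h
  refine h.congr fun z => ?_
  exact intervalIntegral.integral_interval_add_Ioi hi.integrableOn hi.integrableOn

theorem abs_Theta_le_one (hi : Integrable σ) (h0 : ∀ y, 0 ≤ σ y) (h1 : ∫ y, σ y = 1) (x z : ℝ) :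
    |Theta σ x z| ≤ 1 := by
  have ha : 0 ≤ ∫ y in Set.Ioi z, σ y := integral_nonneg h0
  have hb : ∫ y in Set.Ioi z, σ y ≤ 1 :=
    h1 ▸ setIntegral_le_integral hi (Eventually.of_forall h0)
  rw [Theta, abs_le]
  by_cases hz : z ∈ Set.Iic x
  · rw [Set.indicator_of_mem hz]
    constructor <;> linarith
  · rw [Set.indicator_of_notMem hz]
    constructor <;> linarith

theorem measurable_Theta (hc : Continuous σ) (hi : Integrable σ) (x : ℝ) :
    Measurable (Theta σ x) :=
  (measurable_const.indicator measurableSet_Iic).sub (continuous_integral_Ioi hc hi).measurable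

theorem continuousAt_Theta (hc : Continuous σ) (hi : Integrable σ) {x t : ℝ} (ht : t ≠ x) :
    ContinuousAt (Theta σ x) t := by
  refine ContinuousAt.sub ?_ (continuous_integral_Ioi hc hi).continuousAt
  rcases ht.lt_or_gt with h | h
  · refine (continuousAt_const (y := (1 : ℝ))).congr ?_
    filter_upwards [Iio_mem_nhds h] with z hz
    rw [Set.indicator_of_mem (Set.mem_Iic.2 (le_of_lt hz))]
  · refine (continuousAt_const (y := (0 : ℝ))).congr ?_
    filter_upwards [Ioi_mem_nhds h] with z hz
    rw [Set.indicator_of_notMem (Set.notMem_Iic.2 hz)]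

theorem integral_Theta_sq_mul (hc : Continuous σ) (hi : Integrable σ) (h0 : ∀ y, 0 ≤ σ y)
    (h1 : ∫ y, σ y = 1) (x : ℝ) :
    ∫ z, Theta σ x z ^ 2 * σ z =
      1 / 3 + (∫ y in Set.Ioi x, σ y) ^ 2 - ∫ y in Set.Ioi x, σ y := by
  set F : ℝ → ℝ := fun z => ∫ y in Set.Ioi z, σ y with hF
  have hFc : Continuous F := continuous_integral_Ioi hc hi
  have hd : ∀ z, HasDerivAt F (-σ z) z := hasDerivAt_integral_Ioi hc hi
  have hbot : Tendsto F atBot (𝓝 1) := h1 ▸ tendsto_integral_Ioi_atBot hi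
  have htop : Tendsto F atTop (𝓝 0) := tendsto_integral_Ioi_atTop hi
  have hFle : ∀ z, |F z| ≤ 1 := fun z => by
    rw [abs_of_nonneg (integral_nonneg h0)]
    exact h1 ▸ setIntegral_le_integral hi (Eventually.of_forall h0)
  have hint2 : Integrable fun z => F z ^ 2 * σ z := by
    refine hi.bdd_mul (c := 1) (hFc.pow 2).aestronglyMeasurable (Eventually.of_forall fun z => ?_)
    rw [norm_pow]
    exact pow_le_one₀ (norm_nonneg _) (hFle z)
  have hint1 : Integrable fun z => (1 - 2 * F z) * σ z := by
    refine hi.bdd_mul (c := 3) (by fun_prop) (Eventually.of_forall fun z => ?_)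
    have := abs_le.1 (hFle z)
    rw [Real.norm_eq_abs, abs_le]
    constructor <;> linarith
  have e2 : ∫ z, F z ^ 2 * σ z = 1 / 3 := by
    rw [integral_of_hasDerivAt_of_tendsto (f := fun z => -(F z ^ 3) / 3) (m := -(1 ^ 3) / 3)
      (n := -(0 ^ 3) / 3) (fun z => ?_) hint2 ((hbot.pow 3).neg.div_const 3)
      ((htop.pow 3).neg.div_const 3)]
    · norm_num
    · refine (((hd z).pow 3).neg.div_const 3).congr_deriv ?_
      norm_num
      ring
  have e1 : ∫ z in Set.Iic x, (1 - 2 * F z) * σ z = F x ^ 2 - F x := by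
    rw [integral_Iic_of_hasDerivAt_of_tendsto' (f := fun z => F z ^ 2 - F z) (m := 1 ^ 2 - 1)
      (fun z _ => ?_) hint1.integrableOn ((hbot.pow 2).sub hbot)]
    · norm_num
    · refine (((hd z).pow 2).sub (hd z)).congr_deriv ?_
      norm_num
      ring
  have hsplit : ∀ z, Theta σ x z ^ 2 * σ z =
      F z ^ 2 * σ z + (Set.Iic x).indicator (fun z => (1 - 2 * F z) * σ z) z := fun z => by
    by_cases hz : z ∈ Set.Iic x
    · simp only [Theta, Set.indicator_of_mem hz, hF]
      ring
    · simp only [Theta, Set.indicator_of_notMem hz, hF]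
      ring
  simp_rw [hsplit]
  rw [integral_add hint2 (hint1.indicator measurableSet_Iic),
    integral_indicator measurableSet_Iic, e1, e2]
  ring

end Tail

section Kernel

variable {σ η : ℝ → ℝ}

theorem integral_Ici_zero_eq_half_of_even (hη : Integrable η) (he : ∀ u, η (-u) = η u) :
    ∫ u in Set.Ici 0, η u = (∫ u, η u) / 2 := by
  have h := integral_comp_neg_Iic 0 η
  simp_rw [he, neg_zero] at h
  have h' := intervalIntegral.integral_Iic_add_Ioi (b := (0 : ℝ)) hη.integrableOn hη.integrableOn
  rw [integral_Ici_eq_integral_Ioi]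
  linarith

theorem tendsto_sub_div_natCast (t u : ℝ) :
    Tendsto (fun L : ℕ => t - u / (L : ℝ)) atTop (𝓝 t) := by
  simpa using (tendsto_const_div_atTop_nhds_zero_nat u).const_sub t

theorem aestronglyMeasurable_mul_Theta (hc : Continuous σ) (hi : Integrable σ)
    (hη : Integrable η) (L : ℕ) (x t : ℝ) :
    AEStronglyMeasurable fun u => η u * Theta σ x (t - u / L) :=
  hη.aestronglyMeasurable.mul
    ((measurable_Theta hc hi x).comp (by fun_prop)).aestronglyMeasurable

theorem norm_mul_Theta_le (hi : Integrable σ) (h0 : ∀ y, 0 ≤ σ y) (h1 : ∫ y, σ y = 1)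
    (u x z : ℝ) : ‖η u * Theta σ x z‖ ≤ ‖η u‖ := by
  rw [norm_mul]
  exact mul_le_of_le_one_right (norm_nonneg _) (abs_Theta_le_one hi h0 h1 x z)

theorem tendsto_integral_mul_Theta_of_ne (hc : Continuous σ) (hi : Integrable σ)
    (h0 : ∀ y, 0 ≤ σ y) (h1 : ∫ y, σ y = 1) (hη : Integrable η) (hη1 : ∫ u, η u = 1) {x t : ℝ}
    (ht : t ≠ x) :
    Tendsto (fun L : ℕ => ∫ u, η u * Theta σ x (t - u / L)) atTop (𝓝 (Theta σ x t)) := by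
  have h : Theta σ x t = ∫ u, η u * Theta σ x t := by
    rw [integral_mul_const, hη1, one_mul]
  rw [h]
  refine tendsto_integral_of_dominated_convergence (fun u => ‖η u‖)
    (fun L => aestronglyMeasurable_mul_Theta hc hi hη L x t) hη.norm
    (fun L => Eventually.of_forall fun u => norm_mul_Theta_le hi h0 h1 u x _)
    (Eventually.of_forall fun u => ?_)
  exact ((continuousAt_Theta hc hi ht).tendsto.comp (tendsto_sub_div_natCast t u)).const_mul _

theorem tendsto_integral_mul_Theta_self (hc : Continuous σ) (hi : Integrable σ)
    (h0 : ∀ y, 0 ≤ σ y) (h1 : ∫ y, σ y = 1) (hη : Integrable η) (he : ∀ u, η (-u) = η u)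
    (hη1 : ∫ u, η u = 1) (x : ℝ) :
    Tendsto (fun L : ℕ => ∫ u, η u * Theta σ x (x - u / L)) atTop
      (𝓝 (1 / 2 - ∫ y in Set.Ioi x, σ y)) := by
  have h : 1 / 2 - ∫ y in Set.Ioi x, σ y =
      ∫ u, (Set.Ici 0).indicator η u - η u * ∫ y in Set.Ioi x, σ y := by
    rw [integral_sub (hη.indicator measurableSet_Ici) (hη.mul_const _),
      integral_indicator measurableSet_Ici, integral_Ici_zero_eq_half_of_even hη he,
      integral_mul_const, hη1, one_mul]
  rw [h]
  refine tendsto_integral_of_dominated_convergence (fun u => ‖η u‖)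
    (fun L => aestronglyMeasurable_mul_Theta hc hi hη L x x) hη.norm
    (fun L => Eventually.of_forall fun u => norm_mul_Theta_le hi h0 h1 u x _)
    (Eventually.of_forall fun u => ?_)
  have hF : Tendsto (fun L : ℕ => η u * ∫ y in Set.Ioi (x - u / L), σ y) atTop
      (𝓝 (η u * ∫ y in Set.Ioi x, σ y)) :=
    (((continuous_integral_Ioi hc hi).tendsto x).comp (tendsto_sub_div_natCast x u)).const_mul _
  refine (tendsto_const_nhds.sub hF).congr' ?_
  filter_upwards [eventually_gt_atTop 0] with L hL
  have hL' : (0 : ℝ) < L := Nat.cast_pos.2 hL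
  rw [Theta, mul_sub]
  by_cases hu : 0 ≤ u
  · rw [Set.indicator_of_mem (Set.mem_Ici.2 hu), Set.indicator_of_mem, mul_one]
    exact Set.mem_Iic.2 (sub_le_self _ (div_nonneg hu hL'.le))
  · rw [Set.indicator_of_notMem (by simpa using hu), Set.indicator_of_notMem, mul_zero]
    have : u / L < 0 := div_neg_of_neg_of_pos (not_le.1 hu) hL'
    simpa using this

theorem norm_integral_mul_Theta_le (hi : Integrable σ) (h0 : ∀ y, 0 ≤ σ y) (h1 : ∫ y, σ y = 1)
    (hη : Integrable η) (L : ℕ) (x t : ℝ) :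
    ‖∫ u, η u * Theta σ x (t - u / L)‖ ≤ ∫ u, ‖η u‖ :=
  norm_integral_le_of_norm_le hη.norm
    (Eventually.of_forall fun u => norm_mul_Theta_le hi h0 h1 u x _)

theorem aestronglyMeasurable_integral_mul_Theta (hc : Continuous σ) (hi : Integrable σ)
    (hη : Integrable η) (L : ℕ) (x : ℝ) :
    AEStronglyMeasurable fun t => ∫ u, η u * Theta σ x (t - u / L) := by
  refine AEStronglyMeasurable.integral_prod_right'
    (f := fun p : ℝ × ℝ => η p.2 * Theta σ x (p.1 - p.2 / L)) ?_
  exact hη.aestronglyMeasurable.comp_snd.mul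
    ((measurable_Theta hc hi x).comp (by fun_prop)).aestronglyMeasurable

theorem tendsto_integral_sq_mul (hc : Continuous σ) (hi : Integrable σ)
    (h0 : ∀ y, 0 ≤ σ y) (h1 : ∫ y, σ y = 1) (hη : Integrable η) (hη1 : ∫ u, η u = 1) (x : ℝ) :
    Tendsto (fun L : ℕ => ∫ t, (∫ u, η u * Theta σ x (t - u / L)) ^ 2 * σ t) atTop
      (𝓝 (∫ t, Theta σ x t ^ 2 * σ t)) := by
  refine tendsto_integral_of_dominated_convergence (fun t => (∫ u, ‖η u‖) ^ 2 * ‖σ t‖)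
    (fun L => ((aestronglyMeasurable_integral_mul_Theta hc hi hη L x).pow 2).mul
      hc.aestronglyMeasurable) (hi.norm.const_mul _)
    (fun L => Eventually.of_forall fun t => ?_) ?_
  · rw [norm_mul, norm_pow]
    gcongr
    exact norm_integral_mul_Theta_le hi h0 h1 hη L x t
  · filter_upwards [Measure.ae_ne volume x] with t ht
    exact ((tendsto_integral_mul_Theta_of_ne hc hi h0 h1 hη hη1 ht).pow 2).mul_const _

end Kernel

section Mollify

variable {ρ : ℝ → ℝ}

theorem integral_mollify_mul_mollify {L : ℕ} (hL : 0 < L) (s : ℝ) :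
    ∫ w, mollify ρ L (s - w) * mollify ρ L w =
      L * ∫ v, ρ (L * s - v) * ρ v := by
  have hL' : (0 : ℝ) < L := Nat.cast_pos.2 hL
  have h := Measure.integral_comp_mul_left (fun v => ρ (L * s - v) * ρ v) (L : ℝ)
  rw [abs_of_pos (inv_pos.2 hL'), smul_eq_mul] at h
  have e : ∀ w, mollify ρ L (s - w) * mollify ρ L w =
      (L : ℝ) ^ 2 * (ρ (L * s - L * w) * ρ (L * w)) := fun w => by
    simp only [mollify, mul_sub]
    ring
  simp_rw [e]
  rw [integral_const_mul, h]
  field_simp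

theorem doubleConv_eq (σ : ℝ → ℝ) {L : ℕ} (hL : 0 < L) (x t : ℝ) :
    doubleConv σ ρ L x t = ∫ u, (∫ v, ρ (u - v) * ρ v) * Theta σ x (t - u / L) := by
  have hL' : (0 : ℝ) < L := Nat.cast_pos.2 hL
  simp_rw [doubleConv, integral_mollify_mul_mollify hL]
  rw [← integral_sub_left_eq_self _ volume t]
  have h := Measure.integral_comp_mul_left
    (fun u => (∫ v, ρ (u - v) * ρ v) * Theta σ x (t - u / L)) (L : ℝ)
  rw [abs_of_pos (inv_pos.2 hL'), smul_eq_mul, eq_comm, inv_mul_eq_iff_eq_mul₀ hL'.ne'] at h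
  rw [h, ← integral_const_mul]
  refine integral_congr_ae (Eventually.of_forall fun z => ?_)
  simp only [sub_sub_cancel, mul_div_cancel_left₀ z hL'.ne']
  ring

theorem integral_comp_sub_mul_even (he : ∀ y, ρ (-y) = ρ y) (u : ℝ) :
    ∫ v, ρ (-u - v) * ρ v = ∫ v, ρ (u - v) * ρ v := by
  rw [← integral_neg_eq_self]
  refine integral_congr_ae (Eventually.of_forall fun v => ?_)
  simp only [he]
  rw [← he, neg_sub, neg_sub_neg, ← he, neg_sub]

theorem convolution_mul_self_eq :
    (fun u => ∫ v, ρ (u - v) * ρ v) =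
      convolution ρ ρ (ContinuousLinearMap.mul ℝ ℝ) volume := by
  funext u
  simp only [convolution, ContinuousLinearMap.mul_apply']
  exact integral_congr_ae (Eventually.of_forall fun v => mul_comm _ _)

end Mollify

theorem stmt_10 (σ : ℝ → ℝ) (hσ_smooth : ContDiff ℝ (⊤ : ℕ∞) σ) (hσ_supp : HasCompactSupport σ)
    (hσ_nonneg : ∀ y, 0 ≤ σ y) (hσ_int : ∫ y, σ y = 1)
    (ρ : SchwartzMap ℝ ℝ) (hρ_even : ∀ y, ρ (-y) = ρ y) (hρ_int : ∫ y, ρ y = 1) (x : ℝ) :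
    Tendsto
      (fun L : ℕ =>
        (doubleConv σ ρ L x x) ^ 2 - ∫ z, (doubleConv σ ρ L x z) ^ 2 * σ z)
      atTop (nhds (-(1 / 12))) := by
  have hc : Continuous σ := hσ_smooth.continuous
  have hi : Integrable σ := hc.integrable_of_hasCompactSupport hσ_supp
  have hρ : Integrable ρ := ρ.integrable
  have hη : Integrable fun u => ∫ v, ρ (u - v) * ρ v := by
    rw [convolution_mul_self_eq]
    exact hρ.integrable_convolution _ hρ
  have hη1 : ∫ u, ∫ v, ρ (u - v) * ρ v = 1 := by
    rw [convolution_mul_self_eq, integral_convolution _ hρ hρ, hρ_int]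
    simp
  have hlim := ((tendsto_integral_mul_Theta_self hc hi hσ_nonneg hσ_int hη
    (integral_comp_sub_mul_even hρ_even) hη1 x).pow 2).sub
      (tendsto_integral_sq_mul hc hi hσ_nonneg hσ_int hη hη1 x)
  rw [integral_Theta_sq_mul hc hi hσ_nonneg hσ_int] at hlim
  have hval : (1 / 2 - ∫ y in Set.Ioi x, σ y) ^ 2 -
      (1 / 3 + (∫ y in Set.Ioi x, σ y) ^ 2 - ∫ y in Set.Ioi x, σ y) = -(1 / 12) := by ring
  rw [hval] at hlim
  refine hlim.congr' ?_
  filter_upwards [eventually_gt_atTop 0] with L hL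
  simp_rw [doubleConv_eq σ hL]
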